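/- Let p > 3 be a prime and let a be a rational number whose denominator is coprime to p. Then Σ_{k=1}^{p-1} C(-a,k)·C(a-1,k)·H_k/k ≡ (-1)^{⟨-a⟩_p} · E_{p-3}(a) (mod p). -/

import Mathlib

open Finset

/-- Generalized binomial coefficient `C(a,k) = a(a-1)⋯(a-k+1)/k!` for a rational `a`. -/
noncomputable def gchoose (a : ℚ) (k : ℕ) : ℚ :=
  (∏ j ∈ Finset.range k, (a - j)) / (Nat.factorial k : ℚ)

/-- The harmonic number `H_k = ∑_{j=1}^k 1/j`. -/
def harm (k : ℕ) : ℚ := ∑ j ∈ Finset.range k, (1 : ℚ) / (j + 1)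

/-- The second-order harmonic number `H_k^{(2)} = ∑_{j=1}^k 1/j²`. -/
def harm2 (k : ℕ) : ℚ := ∑ j ∈ Finset.range k, (1 : ℚ) / (j + 1) ^ 2

/-- `x ≡ y (mod p^m)` for rationals: the p-adic valuation of `x - y` is at least `m`
(with the convention that the valuation of `0` is `+∞`). -/
def CongrMod (p m : ℕ) (x y : ℚ) : Prop :=
  x = y ∨ (m : ℤ) ≤ padicValRat p (x - y)

/-- The Bernoulli polynomial `B_n` evaluated at a rational `x`. -/
noncomputable def bpoly (n : ℕ) (x : ℚ) : ℚ := (Polynomial.bernoulli n).eval x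

/-- The Euler polynomial `E_n` evaluated at a rational `x`, via
`E_n(x) = (2/(n+1))·(B_{n+1}(x) − 2^{n+1}·B_{n+1}(x/2))`. -/
noncomputable def epoly (n : ℕ) (x : ℚ) : ℚ :=
  (2 / (n + 1 : ℚ)) * (bpoly (n + 1) x - 2 ^ (n + 1) * bpoly (n + 1) (x / 2))

/-- The Euler number `E_n = 2^n · E_n(1/2)`. -/
noncomputable def eulerNum (n : ℕ) : ℚ := 2 ^ n * epoly n (1 / 2)

/-- `x` and `y` are `p`-integral rationals that agree modulo `p`. -/
def IntCongr (p : ℕ) (x y : ℚ) : Prop :=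
  padicNorm p x ≤ 1 ∧ padicNorm p y ≤ 1 ∧ padicNorm p (x - y) < 1

namespace IntCongr

variable {p : ℕ} {x y z w : ℚ}

lemma refl_of_le (h : padicNorm p x ≤ 1) : IntCongr p x x := ⟨h, h, by simp⟩

lemma symm (h : IntCongr p x y) : IntCongr p y x :=
  ⟨h.2.1, h.1, by rw [← neg_sub, padicNorm.neg]; exact h.2.2⟩

lemma neg (h : IntCongr p x y) : IntCongr p (-x) (-y) := by
  refine ⟨by rw [padicNorm.neg]; exact h.1, by rw [padicNorm.neg]; exact h.2.1, ?_⟩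
  rw [neg_sub_neg]
  exact h.symm.2.2

variable [hp : Fact p.Prime]

lemma trans (h : IntCongr p x y) (h' : IntCongr p y z) : IntCongr p x z := by
  refine ⟨h.1, h'.2.1, ?_⟩
  rw [← sub_add_sub_cancel x y z]
  exact padicNorm.nonarchimedean.trans_lt (max_lt h.2.2 h'.2.2)

lemma natCast (n : ℕ) : IntCongr p n n := refl_of_le (padicNorm.of_nat n)

lemma add (h : IntCongr p x y) (h' : IntCongr p z w) : IntCongr p (x + z) (y + w) := by
  refine ⟨padicNorm.nonarchimedean.trans (max_le h.1 h'.1),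
    padicNorm.nonarchimedean.trans (max_le h.2.1 h'.2.1), ?_⟩
  rw [add_sub_add_comm]
  exact padicNorm.nonarchimedean.trans_lt (max_lt h.2.2 h'.2.2)

lemma sub (h : IntCongr p x y) (h' : IntCongr p z w) : IntCongr p (x - z) (y - w) := by
  simpa [sub_eq_add_neg] using h.add h'.neg

lemma mul (h : IntCongr p x y) (h' : IntCongr p z w) : IntCongr p (x * z) (y * w) := by
  refine ⟨?_, ?_, ?_⟩
  · rw [padicNorm.mul]
    exact mul_le_one₀ h.1 (padicNorm.nonneg _) h'.1
  · rw [padicNorm.mul]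
    exact mul_le_one₀ h.2.1 (padicNorm.nonneg _) h'.2.1
  · rw [show x * z - y * w = (x - y) * z + y * (z - w) by ring]
    refine padicNorm.nonarchimedean.trans_lt (max_lt ?_ ?_)
    · rw [padicNorm.mul]
      exact mul_lt_one_of_nonneg_of_lt_one_left (padicNorm.nonneg _) h.2.2 h'.1
    · rw [padicNorm.mul]
      exact mul_lt_one_of_nonneg_of_lt_one_right h.2.1 (padicNorm.nonneg _) h'.2.2

lemma pow (h : IntCongr p x y) (n : ℕ) : IntCongr p (x ^ n) (y ^ n) := by
  induction n with
  | zero => simpa using natCast (p := p) 1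
  | succ n ih => simpa only [pow_succ] using ih.mul h

lemma sum {ι : Type*} {s : Finset ι} {f g : ι → ℚ} (h : ∀ i ∈ s, IntCongr p (f i) (g i)) :
    IntCongr p (∑ i ∈ s, f i) (∑ i ∈ s, g i) := by
  classical
  induction s using Finset.induction_on with
  | empty => simpa using natCast (p := p) 0
  | insert i s hi ih =>
    rw [sum_insert hi, sum_insert hi]
    exact (h i (mem_insert_self i s)).add (ih fun j hj => h j (mem_insert_of_mem hj))

lemma prod {ι : Type*} {s : Finset ι} {f g : ι → ℚ} (h : ∀ i ∈ s, IntCongr p (f i) (g i)) :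
    IntCongr p (∏ i ∈ s, f i) (∏ i ∈ s, g i) := by
  classical
  induction s using Finset.induction_on with
  | empty => simpa using natCast (p := p) 1
  | insert i s hi ih =>
    rw [prod_insert hi, prod_insert hi]
    exact (h i (mem_insert_self i s)).mul (ih fun j hj => h j (mem_insert_of_mem hj))

lemma inv_natCast {n : ℕ} (h : ¬ p ∣ n) : IntCongr p (n : ℚ)⁻¹ (n : ℚ)⁻¹ := by
  refine refl_of_le ?_
  rw [← one_div, padicNorm.div, (padicNorm.nat_eq_one_iff n).2 h]
  simp

lemma inv_of_lt {n : ℕ} (h0 : n ≠ 0) (h : n < p) : IntCongr p (n : ℚ)⁻¹ (n : ℚ)⁻¹ :=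
  inv_natCast (Nat.not_dvd_of_pos_of_lt (Nat.pos_of_ne_zero h0) h)

lemma of_den {a : ℚ} (h : ¬ p ∣ a.den) : IntCongr p a a := by
  have := (refl_of_le (padicNorm.of_int (p := p) a.num)).mul (inv_natCast h)
  rwa [← div_eq_mul_inv, Rat.num_div_den] at this

lemma congrMod (h : IntCongr p x y) : CongrMod p 1 x y := by
  rcases eq_or_ne x y with hxy | hxy
  · exact Or.inl hxy
  · right
    have h1 := h.2.2
    rw [padicNorm.eq_zpow_of_nonzero (sub_ne_zero.2 hxy),
      zpow_lt_one_iff_right₀ (by exact_mod_cast hp.1.one_lt)] at h1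
    push_cast
    omega

lemma of_congrMod (h : CongrMod p 1 x y) (hx : IntCongr p x x) (hy : IntCongr p y y) :
    IntCongr p x y := by
  rcases h with rfl | h
  · exact hx
  · refine ⟨hx.1, hy.1, ?_⟩
    rcases eq_or_ne x y with rfl | hxy
    · simp
    · rw [padicNorm.eq_zpow_of_nonzero (sub_ne_zero.2 hxy),
        zpow_lt_one_iff_right₀ (by exact_mod_cast hp.1.one_lt)]
      push_cast at h
      omega

lemma pow_sub_three {s : ℕ} (hp3 : 3 < p) (h0 : s ≠ 0) (h : s < p) :
    IntCongr p ((s : ℚ) ^ (p - 3)) (1 / (s : ℚ) ^ 2) := by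
  have hs : (s : ℚ) ≠ 0 := by exact_mod_cast h0
  have key : IntCongr p ((s : ℚ) ^ (p - 1)) 1 := by
    have hone : IntCongr p 1 1 := by simpa using natCast (p := p) 1
    refine ⟨((natCast s).pow _).1, hone.1, ?_⟩
    have h2 := (Int.ModEq.pow_card_sub_one_eq_one hp.1 (n := (s : ℤ)) (by
      rw [Nat.isCoprime_iff_coprime]
      exact ((Nat.Prime.coprime_iff_not_dvd hp.1).2
          (Nat.not_dvd_of_pos_of_lt (Nat.pos_of_ne_zero h0) h)).symm)).symm.dvd
    have h3 := (padicNorm.int_lt_one_iff _).2 h2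
    push_cast at h3
    exact h3
  have h4 := key.mul ((inv_of_lt h0 h).pow 2)
  have e : p - 1 = p - 3 + 2 := by omega
  convert h4 using 1
  · rw [e, pow_add]; field_simp
  · field_simp

lemma gchoose {k : ℕ} (h : IntCongr p x y) (hk : k < p) :
    IntCongr p (gchoose x k) (gchoose y k) := by
  unfold _root_.gchoose
  rw [div_eq_mul_inv, div_eq_mul_inv]
  refine (prod fun j _ => h.sub (natCast j)).mul (inv_natCast ?_)
  rw [hp.1.dvd_factorial]
  omega

lemma harm {k : ℕ} (hk : k < p) : IntCongr p (harm k) (harm k) := by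
  unfold _root_.harm
  refine sum fun j hj => ?_
  have := inv_of_lt (p := p) (n := j + 1) (by omega) (by have := mem_range.1 hj; omega)
  simpa using this

lemma bpoly {n : ℕ} (hn : n + 1 < p) (h : IntCongr p x y) :
    IntCongr p (bpoly n x) (bpoly n y) := by
  induction n using Nat.strong_induction_on with
  | _ n ih =>
    have hrec (x : ℚ) : _root_.bpoly n x = x ^ n - ((n + 1 : ℕ) : ℚ)⁻¹ *
        ∑ k ∈ range n, ((n + 1).choose k : ℚ) * _root_.bpoly k x := by
      have := congrArg (Polynomial.eval x) (Polynomial.bernoulli_eq_sub_sum n)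
      simp only [nsmul_eq_mul, Polynomial.eval_mul, Polynomial.eval_natCast,
        Polynomial.eval_sub, Polynomial.eval_pow, Polynomial.eval_X,
        Polynomial.eval_finsetSum] at this
      unfold _root_.bpoly
      have h0 : ((n + 1 : ℕ) : ℚ) ≠ 0 := by positivity
      field_simp
      linear_combination this
    rw [hrec, hrec]
    refine (h.pow n).sub ((inv_of_lt (by omega) hn).mul (sum fun k hk => ?_))
    have hk := mem_range.1 hk
    exact (natCast _).mul (ih k hk (by omega))

lemma epoly {n : ℕ} (hn : n + 2 < p) (h : IntCongr p x y) :
    IntCongr p (epoly n x) (epoly n y) := by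
  have hhalf := inv_of_lt (p := p) (n := 2) (by omega) (by omega)
  have h2 := natCast (p := p) 2
  have hn1 := inv_of_lt (p := p) (n := n + 1) (by omega) (by omega)
  push_cast at hhalf h2 hn1
  unfold _root_.epoly
  simp only [div_eq_mul_inv]
  exact (h2.mul hn1).mul ((bpoly hn h).sub ((h2.pow _).mul (bpoly hn (h.mul hhalf))))

end IntCongr

lemma bpoly_add_one (n : ℕ) (x : ℚ) : bpoly n (x + 1) = bpoly n x + n * x ^ (n - 1) := by
  unfold bpoly
  rw [add_comm x 1, Polynomial.bernoulli_eval_one_add]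

open Polynomial in
lemma Polynomial.eq_C_of_eval_add_one {Q : ℚ[X]} (h : ∀ x, Q.eval (x + 1) = Q.eval x) :
    Q = C (Q.eval 0) := by
  have h' (n : ℕ) : Q.eval (n : ℚ) = Q.eval 0 := by
    induction n with
    | zero => simp
    | succ n ih => push_cast; rw [h, ih]
  refine Polynomial.eq_of_infinite_eval_eq _ _ ?_
  refine (Set.infinite_range_of_injective (Nat.cast_injective (R := ℚ))).mono ?_
  rintro _ ⟨n, rfl⟩
  simp [h']

open Polynomial in
/-- The multiplication theorem for Bernoulli polynomials, with multiplier two. -/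
lemma bpoly_half_add_bpoly_half (n : ℕ) (x : ℚ) :
    2 ^ n * (bpoly n (x / 2) + bpoly n ((x + 1) / 2)) = 2 * bpoly n x := by
  let Q (n : ℕ) : ℚ[X] := C (2 ^ n) * ((Polynomial.bernoulli n).comp (C (1 / 2) * X) +
    (Polynomial.bernoulli n).comp (C (1 / 2) * (X + 1))) - C 2 * Polynomial.bernoulli n
  have heval (n : ℕ) (x : ℚ) : (Q n).eval x =
      2 ^ n * (bpoly n (x / 2) + bpoly n ((x + 1) / 2)) - 2 * bpoly n x := by
    simp [Q, bpoly, div_eq_inv_mul]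
  have hper (n : ℕ) (x : ℚ) : (Q n).eval (x + 1) = (Q n).eval x := by
    rw [heval, heval, show (x + 1 + 1) / 2 = x / 2 + 1 by ring, bpoly_add_one, bpoly_add_one]
    rcases n with _ | n
    · simp; ring
    · simp only [Nat.add_sub_cancel, div_pow]
      field_simp
      ring
  have hder : derivative (Q (n + 1)) = C (n + 1 : ℚ) * Q n := by
    have e : (C (2 ^ (n + 1)) : ℚ[X]) * C (1 / 2) = C (2 ^ n) := by
      rw [← C_mul]; congr 1; ring
    simp only [Q, derivative_sub, derivative_mul, derivative_C, derivative_add,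
      derivative_comp, derivative_X, derivative_one, Polynomial.derivative_bernoulli_add_one,
      mul_comp, add_comp, natCast_comp, one_comp, C_add, C_1, map_natCast]
    linear_combination ((n : ℚ[X]) + 1) * ((Polynomial.bernoulli n).comp (C (1 / 2) * X) +
      (Polynomial.bernoulli n).comp (C (1 / 2) * (X + 1))) * e
  rw [Polynomial.eq_C_of_eval_add_one (hper (n + 1)), derivative_C] at hder
  have hQ : Q n = 0 := by
    rcases mul_eq_zero.1 hder.symm with h | h
    · rw [C_eq_zero] at h
      exact absurd h (by positivity)
    · exact h
  have := heval n x
  rw [hQ, eval_zero] at this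
  linarith

lemma epoly_add_one (n : ℕ) (x : ℚ) : epoly n (x + 1) + epoly n x = 2 * x ^ n := by
  have h1 := bpoly_half_add_bpoly_half (n + 1) x
  have h2 := bpoly_add_one (n + 1) x
  rw [Nat.add_sub_cancel] at h2
  push_cast at h2
  have h0 : (n + 1 : ℚ) ≠ 0 := by positivity
  unfold epoly
  rw [h2]
  field_simp
  linear_combination -h1

lemma epoly_zero {n : ℕ} (hn : Even n) (h0 : n ≠ 0) : epoly n 0 = 0 := by
  have : bpoly (n + 1) 0 = 0 := by
    unfold bpoly
    rw [Polynomial.bernoulli_eval_zero, bernoulli_eq_zero_of_odd hn.add_one (by omega)]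
  simp [epoly, this]

lemma neg_one_pow_mul_epoly_neg {n : ℕ} (hn : Even n) (h0 : n ≠ 0) (t : ℕ) :
    (-1) ^ t * epoly n (-t) = 2 * ∑ s ∈ range t, (-1 : ℚ) ^ (s + 1) * ((s + 1 : ℕ) : ℚ) ^ n := by
  induction t with
  | zero => simp [epoly_zero hn h0]
  | succ t ih =>
    have h := epoly_add_one n (-((t + 1 : ℕ) : ℚ))
    rw [hn.neg_pow, show -((t + 1 : ℕ) : ℚ) + 1 = -t by push_cast; ring] at h
    rw [sum_range_succ, mul_add, ← ih]
    linear_combination (-1) ^ (t + 1) * h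

lemma gchoose_natCast (t k : ℕ) : gchoose t k = t.choose k := by
  rw [gchoose, Nat.cast_choose_eq_descPochhammer_div, descPochhammer_eval_eq_prod_range]

lemma gchoose_neg_natCast_sub_one (t k : ℕ) :
    gchoose (-t - 1) k = (-1) ^ k * (t + k).choose k := by
  have h : ((k.factorial * (t + k).choose k : ℕ) : ℚ) = ∏ j ∈ range k, ((t : ℚ) + 1 + j) := by
    rw [← Nat.ascFactorial_eq_factorial_mul_choose, Nat.ascFactorial_eq_prod_range]
    push_cast
    rfl
  have h' : ∏ j ∈ range k, (-(t : ℚ) - 1 - j) = (-1) ^ k * ∏ j ∈ range k, ((t : ℚ) + 1 + j) := by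
    rw [← card_range k, ← prod_const, card_range, ← prod_mul_distrib]
    exact prod_congr rfl fun j _ => by ring
  have h0 : (k.factorial : ℚ) ≠ 0 := by exact_mod_cast k.factorial_ne_zero
  rw [gchoose, h', ← h]
  push_cast
  field_simp

lemma harm_succ (k : ℕ) : harm (k + 1) = harm k + 1 / (k + 1) := by
  rw [harm, sum_range_succ, ← harm]

lemma sum_neg_one_pow_mul_choose_mul_choose (t : ℕ) :
    ∑ k ∈ range (t + 1), (-1 : ℚ) ^ k * t.choose k * (t + 1 + k).choose t = (-1) ^ t := by
  have h := fwdDiff_iter_eq_sum_shift 1 (fun x ↦ x.choose t : ℕ → ℤ) t (t + 1)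
  have h' := congrFun (fwdDiff_iter_choose 0 t) (t + 1)
  rw [add_zero] at h'
  rw [h'] at h
  have h2 := congrArg (fun z : ℤ => (-1 : ℚ) ^ t * (z : ℚ)) h
  simp only [Nat.choose_zero_right, Int.cast_sum, mul_sum, smul_eq_mul, mul_one] at h2
  push_cast at h2
  rw [mul_one] at h2
  rw [h2]
  refine sum_congr rfl fun k hk => ?_
  have hk : k ≤ t := by have := mem_range.1 hk; omega
  obtain ⟨m, rfl⟩ := Nat.exists_eq_add_of_le hk
  rw [Nat.add_sub_cancel_left, pow_add]
  have : ((-1 : ℚ) ^ m) * (-1) ^ m = 1 := by rw [← mul_pow]; simp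
  linear_combination -(-1) ^ k * ((k + m).choose k : ℚ) * ((k + m + 1 + k).choose (k + m) : ℚ) * this

/-- Summation by parts against the harmonic numbers. -/
lemma sum_choose_mul_choose_mul_harm_partial (t m : ℕ) :
    ∑ k ∈ range (m + 1), (-1 : ℚ) ^ k * (t + 1).choose k * (t + k).choose k * harm k =
      (-1) ^ m * t.choose m * (t + 1 + m).choose m * harm m -
        ∑ k ∈ range m, (-1 : ℚ) ^ k * t.choose k * (t + 1 + k).choose k / (k + 1) := by
  induction m with
  | zero => simp [harm]
  | succ m ih =>
    rw [sum_range_succ, ih, sum_range_succ _ m, harm_succ]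
    have h1 : ((t : ℚ) + 1) * t.choose m = (t.choose m + t.choose (m + 1)) * (m + 1) := by
      have := Nat.add_one_mul_choose_eq t m
      rw [Nat.choose_succ_succ] at this
      exact_mod_cast this
    have h2 : ((t + 1 + m).choose (m + 1) : ℚ) * (m + 1) = (t + 1 + m).choose m * (t + 1) := by
      have := Nat.choose_succ_right_eq (t + 1 + m) m
      rw [Nat.add_sub_cancel] at this
      exact_mod_cast this
    rw [show t + (m + 1) = t + 1 + m by ring, show t + 1 + (m + 1) = t + 1 + m + 1 by ring,
      Nat.choose_succ_succ t m, Nat.choose_succ_succ (t + 1 + m) m]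
    push_cast
    have h3 : (t.choose m : ℚ) * (t + 1 + m).choose m -
        (t.choose m + t.choose (m + 1)) * (t + 1 + m).choose (m + 1) +
        t.choose (m + 1) * ((t + 1 + m).choose m + (t + 1 + m).choose (m + 1)) = 0 := by
      have h0 : (m + 1 : ℚ) ≠ 0 := by positivity
      refine (mul_eq_zero.1 ?_).resolve_left h0
      linear_combination -((t + 1 + m).choose m : ℚ) * h1 - (t.choose m : ℚ) * h2
    linear_combination (-1) ^ m * (harm m + 1 / (m + 1)) * h3

lemma sum_choose_mul_choose_mul_harm {t N : ℕ} (hN : t + 1 < N) :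
    ∑ k ∈ range N, (-1 : ℚ) ^ k * (t + 1).choose k * (t + k).choose k * harm k =
      (-1) ^ (t + 1) / (t + 1) := by
  rw [← sum_range_add_sum_Ico _ (show t + 1 + 1 ≤ N by omega),
    sum_choose_mul_choose_mul_harm_partial, Nat.choose_succ_self,
    sum_eq_zero (s := Ico (t + 1 + 1) N)]
  · have h : ∑ k ∈ range (t + 1), (-1 : ℚ) ^ k * t.choose k * (t + 1 + k).choose k / (k + 1) =
        (-1) ^ t / (t + 1) := by
      rw [← sum_neg_one_pow_mul_choose_mul_choose, sum_div]
      refine sum_congr rfl fun k _ => ?_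
      have h1 := Nat.choose_succ_right_eq (t + 1 + k) t
      rw [show t + 1 + k - t = k + 1 by omega, Nat.choose_symm_add] at h1
      have h2 : ((t + 1 + k).choose k : ℚ) * (t + 1) = (t + 1 + k).choose t * (k + 1) := by
        exact_mod_cast h1
      rw [div_eq_div_iff (by positivity) (by positivity)]
      linear_combination (-1) ^ k * (t.choose k : ℚ) * h2
    rw [h]
    push_cast
    ring
  · intro k hk
    rw [Nat.choose_eq_zero_of_lt (show t + 1 < k by have := mem_Ico.1 hk; omega)]
    simp

lemma sum_choose_mul_choose_mul_harm_div {t N : ℕ} (hN : t < N) :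
    ∑ k ∈ range N, (-1 : ℚ) ^ k * t.choose k * (t + k).choose k * harm k / k =
      2 * ∑ s ∈ range t, (-1 : ℚ) ^ (s + 1) * (1 / ((s + 1 : ℕ) : ℚ) ^ 2) := by
  induction t with
  | zero =>
    simp only [range_zero, sum_empty, mul_zero]
    refine sum_eq_zero fun k _ => ?_
    rcases k with _ | k <;> simp
  | succ t ih =>
    rw [sum_range_succ, mul_add, ← ih (by omega), ← sub_eq_iff_eq_add', ← sum_sub_distrib]
    have h := sum_choose_mul_choose_mul_harm hN
    trans 2 / (t + 1) *
      ∑ k ∈ range N, (-1 : ℚ) ^ k * (t + 1).choose k * (t + k).choose k * harm k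
    · rw [mul_sum]
      refine sum_congr rfl fun k _ => ?_
      rcases eq_or_ne k 0 with rfl | hk
      · simp [harm]
      have hk' : (k : ℚ) ≠ 0 := by exact_mod_cast hk
      have h1 : ((t + 1 + k).choose k : ℚ) * (t + 1) = (t + k).choose k * (t + k + 1) := by
        have := Nat.choose_mul_succ_eq (t + k) k
        rw [show t + k + 1 = t + 1 + k by ring, Nat.add_sub_cancel] at this
        rw [show (t : ℚ) + k + 1 = t + 1 + k by ring]
        exact_mod_cast this.symm
      have h2 : (t.choose k : ℚ) * (t + 1) = (t + 1).choose k * (t + 1 - k) := by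
        have := Nat.choose_mul_succ_eq t k
        rcases le_or_gt k (t + 1) with hkt | hkt
        · rw [← Nat.cast_add_one, ← Nat.cast_sub hkt]
          exact_mod_cast this
        · rw [Nat.choose_eq_zero_of_lt hkt, Nat.choose_eq_zero_of_lt (by omega)]
          simp
      have h0 : (t + 1 : ℚ) ≠ 0 := by positivity
      field_simp
      linear_combination harm k * ((t + 1).choose k : ℚ) * h1 - harm k * ((t + k).choose k : ℚ) * h2
    · rw [h]
      have h0 : (t + 1 : ℚ) ≠ 0 := by positivity
      push_cast
      field_simp

theorem stmt_3 (p : ℕ) (hp : p.Prime) (hp3 : 3 < p) (a : ℚ) (ha : ¬ (p ∣ a.den))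
    (t : ℕ) (ht : t < p) (hat : CongrMod p 1 (-a) t) :
    CongrMod p 1
      (∑ k ∈ Finset.Ico 1 p, gchoose (-a) k * gchoose (a - 1) k * harm k / k)
      ((-1 : ℚ) ^ t * epoly (p - 3) a) := by
  have : Fact p.Prime := ⟨hp⟩
  have hneg : IntCongr p (-a) t :=
    IntCongr.of_congrMod hat (IntCongr.of_den ha).neg (IntCongr.natCast t)
  have hpos : IntCongr p a (-t) := by simpa using hneg.neg
  have hone : IntCongr p 1 1 := by simpa using IntCongr.natCast (p := p) 1
  have heven : Even (p - 3) := by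
    obtain ⟨m, hm⟩ := hp.odd_of_ne_two (by omega)
    exact ⟨m - 1, by omega⟩
  refine IntCongr.congrMod (IntCongr.trans (y := (-1) ^ t * epoly (p - 3) (-t)) ?_
    ((hone.neg.pow t).mul (hpos.symm.epoly (by omega))))
  rw [neg_one_pow_mul_epoly_neg heven (by omega)]
  refine IntCongr.trans (y := 2 * ∑ s ∈ range t, (-1 : ℚ) ^ (s + 1) * (1 / ((s + 1 : ℕ) : ℚ) ^ 2))
    ?_ ((IntCongr.natCast 2).mul (IntCongr.sum fun s hs => ?_))
  · rw [← sum_choose_mul_choose_mul_harm_div ht, ← sum_range_add_sum_Ico _ hp.one_lt.le]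
    simp only [range_one, sum_singleton, Nat.cast_zero, div_zero, zero_add]
    refine IntCongr.sum fun k hk => ?_
    have hk := mem_Ico.1 hk
    have h := ((hneg.gchoose hk.2).mul ((hpos.sub hone).gchoose hk.2)).mul (IntCongr.harm hk.2)
    have h' := h.mul (IntCongr.inv_of_lt (n := k) (by omega) hk.2)
    rw [gchoose_natCast, gchoose_neg_natCast_sub_one, ← div_eq_mul_inv, ← div_eq_mul_inv] at h'
    convert h' using 2
    ring
  · have hs := mem_range.1 hs
    exact (hone.neg.pow _).mul (IntCongr.pow_sub_three hp3 (by omega) (by omega)).symm
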